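/- arXiv:2506.15021 — 2 statements merged into one kernel-verified Lean document; each statement's English description precedes it below -/
import Mathlib

section
/- Let E be a real inner product space, C ⊆ E a convex set, L : E → ℝ, θ* ∈ C, η > 0, and B ≥ 0, G ≥ 0 real constants. Let T be a positive integer and let θ¹, …, θ^{T+1} ∈ C and g¹, …, g^T ∈ E be sequences such that for each t = 1, …, T: (i) θ^{t+1} is the metric projection of θ^t − η·g^t onto C, i.e., ⟨(θ^t − η·g^t) − θ^{t+1}, c − θ^{t+1}⟩ ≤ 0 for all c ∈ C; (ii) g^t is a subgradient of L at θ^t relative to C, i.e., L(y) ≥ L(θ^t) + ⟨g^t, y − θ^t⟩ for all y ∈ C; and (iii) ‖g^t‖ ≤ G. Assume ‖θ¹ − θ*‖ ≤ B. Then the total excess loss satisfies ∑_{t=1}^{T} (L(θ^t) − L(θ*)) ≤ B²/(2η) + (η/2)·T·G². -/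
open RealInnerProductSpace

/-- A point `p` satisfying the variational inequality of the projection of `w` at `c` is no farther
from `c` than `w` is. -/
theorem norm_sub_sq_le_of_inner_sub_nonpos
    {E : Type*} [NormedAddCommGroup E] [InnerProductSpace ℝ E]
    {w p c : E} (h : ⟪w - p, c - p⟫ ≤ 0) : ‖p - c‖ ^ 2 ≤ ‖w - c‖ ^ 2 := by
  have h1 : ‖w - c‖ ^ 2 = ‖w - p‖ ^ 2 - 2 * ⟪w - p, c - p⟫ + ‖c - p‖ ^ 2 := by
    rw [← norm_sub_sq_real, sub_sub_sub_cancel_right]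
  rw [norm_sub_rev p c]
  nlinarith [sq_nonneg ‖w - p‖]

/-- One step of projected subgradient descent. -/
theorem sub_le_of_projected_subgradient_step
    {E : Type*} [NormedAddCommGroup E] [InnerProductSpace ℝ E]
    {x p c g : E} {η G a b : ℝ} (hη : 0 < η)
    (hproj : ⟪(x - η • g) - p, c - p⟫ ≤ 0) (hsub : a + ⟪g, c - x⟫ ≤ b) (hg : ‖g‖ ≤ G) :
    a - b ≤ (‖x - c‖ ^ 2 - ‖p - c‖ ^ 2) / (2 * η) + η / 2 * G ^ 2 := by
  have h1 := norm_sub_sq_le_of_inner_sub_nonpos hproj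
  have h2 : ‖x - η • g - c‖ ^ 2 = ‖x - c‖ ^ 2 + 2 * η * ⟪g, c - x⟫ + η ^ 2 * ‖g‖ ^ 2 := by
    rw [sub_right_comm, norm_sub_sq_real, real_inner_smul_right, norm_smul, mul_pow,
      Real.norm_eq_abs, sq_abs, real_inner_comm, ← neg_sub c x, inner_neg_right, norm_neg]
    ring
  have h3 : ‖g‖ ^ 2 ≤ G ^ 2 := by gcongr
  have h4 : η ^ 2 * ‖g‖ ^ 2 ≤ η ^ 2 * G ^ 2 := by gcongr
  have h5 : 2 * η * (a - b) ≤ 2 * η * -⟪g, c - x⟫ := by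
    gcongr
    linarith
  have h6 : (‖x - c‖ ^ 2 - ‖p - c‖ ^ 2) / (2 * η) + η / 2 * G ^ 2
      = (‖x - c‖ ^ 2 - ‖p - c‖ ^ 2 + η ^ 2 * G ^ 2) / (2 * η) := by
    field_simp
  rw [h6, le_div_iff₀ (by positivity)]
  linarith

/-- projected subgradient descent with constant step size `η`:
total excess loss bound `∑_{t=1}^T (L θᵗ − L θ*) ≤ B²/(2η) + (η/2)·T·G²`. -/
theorem projected_subgradient_total_excess_loss
    {E : Type*} [NormedAddCommGroup E] [InnerProductSpace ℝ E]
    (C : Set E) (hC : Convex ℝ C)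
    (L : E → ℝ) (θs : E) (hθs : θs ∈ C)
    (η : ℝ) (hη : 0 < η)
    (B G : ℝ) (hB : 0 ≤ B) (hG : 0 ≤ G)
    (T : ℕ) (hT : 0 < T)
    (θ : ℕ → E) (g : ℕ → E)
    (hmem : ∀ t ∈ Finset.Icc 1 (T + 1), θ t ∈ C)
    (hproj : ∀ t ∈ Finset.Icc 1 T,
      ∀ c ∈ C, ⟪(θ t - η • g t) - θ (t + 1), c - θ (t + 1)⟫ ≤ 0)
    (hsub : ∀ t ∈ Finset.Icc 1 T, ∀ y ∈ C, L (θ t) + ⟪g t, y - θ t⟫ ≤ L y)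
    (hgbound : ∀ t ∈ Finset.Icc 1 T, ‖g t‖ ≤ G)
    (hinit : ‖θ 1 - θs‖ ≤ B) :
    ∑ t ∈ Finset.Icc 1 T, (L (θ t) - L θs) ≤ B ^ 2 / (2 * η) + (η / 2) * T * G ^ 2 := by
  have key : ∀ n ≤ T, ∑ t ∈ Finset.Icc 1 n, (L (θ t) - L θs) ≤
      (‖θ 1 - θs‖ ^ 2 - ‖θ (n + 1) - θs‖ ^ 2) / (2 * η) + (η / 2) * n * G ^ 2 := by
    intro n
    induction n with
    | zero => simp
    | succ n ih =>
      intro hn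
      have ht : n + 1 ∈ Finset.Icc 1 T := Finset.mem_Icc.2 ⟨by omega, hn⟩
      have hstep := sub_le_of_projected_subgradient_step hη (hproj _ ht θs hθs)
        (hsub _ ht θs hθs) (hgbound _ ht)
      have hprev := ih (by omega)
      rw [Finset.sum_Icc_succ_top (by omega)]
      rw [sub_div] at hstep hprev ⊢
      push_cast
      linarith
  refine (key T le_rfl).trans ?_
  have hsq : ‖θ 1 - θs‖ ^ 2 ≤ B ^ 2 := by gcongr
  gcongr
  linarith [sq_nonneg ‖θ (T + 1) - θs‖]
end

section
/- Let E be a real inner product space, C ⊆ E a convex set, and L : E → ℝ a function that is convex on C. Let θ* ∈ C and let B > 0, G > 0 be real constants. Let T be a positive integer, set η = B/(G·√T), and let θ¹, …, θ^{T+1} ∈ C and g¹, …, g^T ∈ E satisfy, for each t = 1, …, T: (i) θ^{t+1} is the metric projection of θ^t − η·g^t onto C (i.e., ⟨(θ^t − η·g^t) − θ^{t+1}, c − θ^{t+1}⟩ ≤ 0 for all c ∈ C); (ii) g^t is a subgradient of L at θ^t relative to C (i.e., L(y) ≥ L(θ^t) + ⟨g^t, y − θ^t⟩ for all y ∈ C);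 and (iii) ‖g^t‖ ≤ G. Assume ‖θ¹ − θ*‖ ≤ B. Then the average iterate θ̄ = (1/T)·∑_{t=1}^{T} θ^t belongs to C and satisfies L(θ̄) − L(θ*) ≤ B·G/√T. -/
open RealInnerProductSpace

/-- If `p` satisfies the obtuse-angle condition of the metric projection of `x` against `s`, then
`p` is no farther from `s` than `x` is. -/
theorem norm_sub_sq_le_of_inner_le_zero {E : Type*} [NormedAddCommGroup E] [InnerProductSpace ℝ E]
    {x p s : E} (h : ⟪x - p, s - p⟫ ≤ 0) : ‖p - s‖ ^ 2 ≤ ‖x - s‖ ^ 2 := by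
  have hx : x - s = (x - p) - (s - p) := by abel
  rw [hx, norm_sub_rev p s, norm_sub_sq_real (x - p)]
  nlinarith [sq_nonneg ‖x - p‖]

/-- The one-step progress inequality of projected subgradient descent. -/
theorem projected_subgradient_step {E : Type*} [NormedAddCommGroup E] [InnerProductSpace ℝ E]
    {L : E → ℝ} {x p s v : E} {η G : ℝ} (hη : 0 ≤ η)
    (hp : ⟪(x - η • v) - p, s - p⟫ ≤ 0) (hv : L x + ⟪v, s - x⟫ ≤ L s) (hvG : ‖v‖ ≤ G) :
    2 * η * (L x - L s) + ‖p - s‖ ^ 2 ≤ ‖x - s‖ ^ 2 + η ^ 2 * G ^ 2 := by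
  have hdist := norm_sub_sq_le_of_inner_le_zero hp
  have hexp : ‖x - η • v - s‖ ^ 2 = ‖x - s‖ ^ 2 + 2 * η * ⟪v, s - x⟫ + η ^ 2 * ‖v‖ ^ 2 := by
    rw [show x - η • v - s = (x - s) - η • v by abel, norm_sub_sq_real, real_inner_smul_right,
      norm_smul, mul_pow, Real.norm_eq_abs, sq_abs, real_inner_comm, ← neg_sub s x,
      inner_neg_right, norm_neg]
    ring
  have hsq : η ^ 2 * ‖v‖ ^ 2 ≤ η ^ 2 * G ^ 2 := by gcongr
  have hlin : 2 * η * (L x - L s) ≤ 2 * η * -⟪v, s - x⟫ := by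
    gcongr
    linarith
  linarith

/-- for `L` convex on `C`, projected subgradient descent with the
tuned step size `η = B/(G·√T)`: the average iterate
`θ̄ = (1/T)·∑_{t=1}^T θᵗ` belongs to `C` and `L θ̄ − L θ* ≤ B·G/√T`. -/
theorem projected_subgradient_average_iterate
    {E : Type*} [NormedAddCommGroup E] [InnerProductSpace ℝ E]
    (C : Set E) (hC : Convex ℝ C)
    (L : E → ℝ) (hL : ConvexOn ℝ C L)
    (θs : E) (hθs : θs ∈ C)
    (B G : ℝ) (hB : 0 < B) (hG : 0 < G)
    (T : ℕ) (hT : 0 < T)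
    (η : ℝ) (hηdef : η = B / (G * Real.sqrt T))
    (θ : ℕ → E) (g : ℕ → E)
    (hmem : ∀ t ∈ Finset.Icc 1 (T + 1), θ t ∈ C)
    (hproj : ∀ t ∈ Finset.Icc 1 T,
      ∀ c ∈ C, ⟪(θ t - η • g t) - θ (t + 1), c - θ (t + 1)⟫ ≤ 0)
    (hsub : ∀ t ∈ Finset.Icc 1 T, ∀ y ∈ C, L (θ t) + ⟪g t, y - θ t⟫ ≤ L y)
    (hgbound : ∀ t ∈ Finset.Icc 1 T, ‖g t‖ ≤ G)
    (hinit : ‖θ 1 - θs‖ ≤ B) :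
    ((1 : ℝ) / T) • (∑ t ∈ Finset.Icc 1 T, θ t) ∈ C ∧
      L (((1 : ℝ) / T) • ∑ t ∈ Finset.Icc 1 T, θ t) - L θs ≤ B * G / Real.sqrt T := by
  have hT0 : (0 : ℝ) < T := by exact_mod_cast hT
  have hmem' : ∀ t ∈ Finset.Icc 1 T, θ t ∈ C := fun t ht =>
    hmem t (Finset.Icc_subset_Icc_right (Nat.le_succ T) ht)
  have hw0 : ∀ t ∈ Finset.Icc 1 T, (0 : ℝ) ≤ 1 / T := fun _ _ => by positivity
  have hw1 : ∑ _t ∈ Finset.Icc 1 T, (1 : ℝ) / T = 1 := by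
    simp [hT0.ne']
  have hη : 0 < η := by rw [hηdef]; positivity
  have htele : ∀ n ≤ T, 2 * η * ∑ t ∈ Finset.Icc 1 n, (L (θ t) - L θs) + ‖θ (n + 1) - θs‖ ^ 2
      ≤ ‖θ 1 - θs‖ ^ 2 + n * (η ^ 2 * G ^ 2) := by
    intro n
    induction n with
    | zero => simp
    | succ n ih =>
      intro hn
      have ht : n + 1 ∈ Finset.Icc 1 T := Finset.mem_Icc.2 ⟨by omega, hn⟩
      have hstep := projected_subgradient_step hη.le (hproj _ ht θs hθs) (hsub _ ht θs hθs)
        (hgbound _ ht)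
      rw [Finset.sum_Icc_succ_top (by omega)]
      push_cast
      linarith [ih (by omega)]
  refine ⟨?_, ?_⟩
  · rw [Finset.smul_sum]
    exact hC.sum_mem hw0 hw1 hmem'
  · have hjensen := hL.map_sum_le hw0 hw1 hmem'
    rw [← Finset.smul_sum, ← Finset.smul_sum, smul_eq_mul] at hjensen
    have hsum := htele T le_rfl
    rw [Finset.sum_sub_distrib, Finset.sum_const, Nat.card_Icc, Nat.add_sub_cancel,
      nsmul_eq_mul] at hsum
    have hinit' : ‖θ 1 - θs‖ ^ 2 ≤ B ^ 2 := by gcongr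
    have hr : 0 < Real.sqrt T := Real.sqrt_pos.2 hT0
    have hrT : Real.sqrt T ^ 2 = T := Real.sq_sqrt hT0.le
    have hηsq : T * (η ^ 2 * G ^ 2) = B ^ 2 := by
      rw [hηdef, div_pow, mul_pow, hrT]
      field_simp
    have hscale : 2 * η * (T * (B * G / Real.sqrt T)) = 2 * B ^ 2 := by
      rw [hηdef]
      field_simp
      rw [hrT]
    have hregret : ∑ t ∈ Finset.Icc 1 T, L (θ t) - T * L θs ≤ T * (B * G / Real.sqrt T) := by
      refine le_of_mul_le_mul_left ?_ (mul_pos two_pos hη)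
      linarith [sq_nonneg ‖θ (T + 1) - θs‖]
    have havg : 1 / (T : ℝ) * ∑ t ∈ Finset.Icc 1 T, L (θ t) ≤ L θs + B * G / Real.sqrt T := by
      rw [one_div_mul_eq_div, div_le_iff₀ hT0]
      linarith
    linarith
end
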